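/- Fix an integer m ≥ 1, fix x ∈ ℝ with 0 < x ≤ 1, and fix N ∈ ℕ. Then, as q → 1⁻ (with q ∈ (0,1)), ψ_q^{(m)}(x) = ψ^{(m)}(x) − ∑_{k=0}^{N} (ζ(1−m−k)/k!)·B_k(x)·(log q)^(m+k) + O((log(1/q))^(m+N+1)). -/

import Mathlib

open Filter Topology Asymptotics Finset Real

/-- The q-polygamma function
`ψ_q^{(m)}(x) = (log q)^{m+1} ∑_{k≥1} k^m q^{kx}/(1-q^k)`. -/
noncomputable def qPolygamma (q : ℝ) (m : ℕ) (x : ℝ) : ℝ :=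
  (Real.log q) ^ (m + 1) *
    ∑' k : ℕ, ((k : ℝ) + 1) ^ m * q ^ (((k : ℝ) + 1) * x) / (1 - q ^ (k + 1))

/-- The classical polygamma function `ψ^{(m)}(x)`, the `m`-th derivative of the digamma
function, i.e. the `(m+1)`-st derivative of `log ∘ Γ`. -/
noncomputable def polygamma (m : ℕ) (x : ℝ) : ℝ :=
  iteratedDeriv (m + 1) (fun y : ℝ => Real.log (Real.Gamma y)) x


noncomputable def emC (n : ℕ) : ℝ := bernoulliFun (n + 1) 1 / ((n + 1).factorial : ℝ)

lemma em_step (g : ℕ → ℝ → ℝ) (hg : ∀ n s, HasDerivAt (g n) (g (n + 1) s) s) (n : ℕ) :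
    ∫ s in (0:ℝ)..1, bernoulliFun n (1 - s) / (n.factorial : ℝ) * g n s =
      emC n * g n 0 - bernoulliFun (n + 1) 0 / ((n + 1).factorial : ℝ) * g n 1
      + ∫ s in (0:ℝ)..1, bernoulliFun (n + 1) (1 - s) / ((n + 1).factorial : ℝ) * g (n + 1) s := by
  have hc : ∀ n, Continuous (g n) := fun n =>
    continuous_iff_continuousAt.2 fun s => (hg n s).continuousAt
  have hu : ∀ s : ℝ, HasDerivAt
      (fun s => -(bernoulliFun (n + 1) (1 - s) / ((n + 1).factorial : ℝ)))
      (bernoulliFun n (1 - s) / (n.factorial : ℝ)) s := by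
    intro s
    have h1 := (hasDerivAt_bernoulliFun (n + 1) (1 - s)).comp s
      ((hasDerivAt_id s).const_sub 1)
    have h2 := (h1.div_const ((n + 1).factorial : ℝ)).neg
    refine h2.congr_deriv ?_
    simp only [Nat.add_sub_cancel, Nat.factorial_succ]
    push_cast
    have : (n.factorial : ℝ) ≠ 0 := by positivity
    have : (n : ℝ) + 1 ≠ 0 := by positivity
    field_simp
  have h1 : ∀ k, Continuous fun s : ℝ => bernoulliFun k (1 - s) / (k.factorial : ℝ) := by
    intro k; fun_prop
  have key := intervalIntegral.integral_deriv_mul_eq_sub (a := 0) (b := 1)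
    (u := fun s => -(bernoulliFun (n + 1) (1 - s) / ((n + 1).factorial : ℝ))) (v := g n)
    (u' := fun s => bernoulliFun n (1 - s) / (n.factorial : ℝ)) (v' := g (n + 1))
    (fun s _ => hu s) (fun s _ => hg n s)
    ((h1 n).intervalIntegrable _ _) ((hc _).intervalIntegrable _ _)
  rw [intervalIntegral.integral_add] at key
  · simp only [neg_mul, intervalIntegral.integral_neg, sub_self, sub_zero] at key
    unfold emC
    linarith
  · exact ((h1 n).mul (hc n)).intervalIntegrable _ _
  · exact ((h1 (n+1)).neg.mul (hc (n + 1))).intervalIntegrable _ _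

lemma em_unit (g : ℕ → ℝ → ℝ) (hg : ∀ n s, HasDerivAt (g n) (g (n + 1) s) s) (M : ℕ) :
    ∫ s in (0:ℝ)..1, g 0 s = g 0 1 + ∑ n ∈ Finset.range (M + 1), emC n * (g n 0 - g n 1)
      + ∫ s in (0:ℝ)..1,
          bernoulliFun (M + 1) (1 - s) / ((M + 1).factorial : ℝ) * g (M + 1) s := by
  induction M with
  | zero =>
    have h := em_step g hg 0
    simp [emC] at h ⊢
    linarith
  | succ M ih =>
    rw [ih, Finset.sum_range_succ _ (M + 1), em_step g hg (M + 1)]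
    have h : bernoulliFun (M + 1 + 1) 0 / ((M + 1 + 1).factorial : ℝ) = emC (M + 1) := by
      rw [emC, bernoulliFun_endpoints_eq_of_ne_one (by omega)]
    rw [h]; ring

/-- Euler-Maclaurin asymptotics for exponentially decaying functions. -/
lemma em_asymp (F : ℕ → ℝ → ℝ) (hF : ∀ n s, HasDerivAt (F n) (F (n + 1) s) s)
    (c : ℝ) (hc : 0 < c) (hb : ∀ n, ∃ C, ∀ u, 0 ≤ u → |F n u| ≤ C * Real.exp (-(c * u))) (M : ℕ) :
    ∃ C, ∀ t : ℝ, 0 < t → t < 1 →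
      |t * ∑' k : ℕ, F 0 (((k : ℝ) + 1) * t) - (∫ u in Set.Ioi (0:ℝ), F 0 u)
        + ∑ n ∈ Finset.range M, emC n * t ^ (n + 1) * F n 0| ≤ C * t ^ (M + 1) := by
  obtain ⟨C1, hC1⟩ := hb (M + 1)
  obtain ⟨C0, hC0⟩ := hb 0
  have hcont : ∀ n, Continuous (F n) := fun n =>
    continuous_iff_continuousAt.2 fun s => (hF n s).continuousAt
  obtain ⟨D, hD⟩ : ∃ D, ∀ s ∈ Set.Icc (0:ℝ) 1,
      ‖bernoulliFun (M + 1) (1 - s) / ((M + 1).factorial : ℝ)‖ ≤ D :=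
    isCompact_Icc.exists_bound_of_continuousOn (by fun_prop)
  have hD0 : 0 ≤ D := (norm_nonneg _).trans (hD 0 (by simp))
  have hC1' : 0 ≤ C1 := by have := (abs_nonneg _).trans (hC1 0 le_rfl); simpa using this
  -- tendsto
  have htend : ∀ n, ∀ t : ℝ, 0 < t →
      Tendsto (fun K : ℕ => F n ((K : ℝ) * t)) atTop (𝓝 0) := by
    intro n t ht
    obtain ⟨C, hC⟩ := hb n
    refine squeeze_zero_norm (a := fun K : ℕ => C * Real.exp (-(c * ((K : ℝ) * t))))
      (fun K => hC _ (by positivity)) ?_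
    have : Tendsto (fun K : ℕ => c * ((K : ℝ) * t)) atTop atTop :=
      (tendsto_natCast_atTop_atTop.atTop_mul_const ht).const_mul_atTop hc
    simpa using (Real.tendsto_exp_neg_atTop_nhds_zero.comp this).const_mul C
  have hint : MeasureTheory.IntegrableOn (F 0) (Set.Ioi 0) := by
    have h1 : MeasureTheory.IntegrableOn (fun u => C0 * Real.exp (-c * u)) (Set.Ioi 0) :=
      (integrableOn_exp_mul_Ioi (by linarith) 0).const_mul _
    refine h1.mono' (hcont 0).aestronglyMeasurable ?_
    filter_upwards [MeasureTheory.ae_restrict_mem measurableSet_Ioi] with u hu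
    have := hC0 u (le_of_lt hu)
    simpa [neg_mul] using this
  refine ⟨|emC M * F M 0| + D * C1 * ((1 + c) / c), fun t ht ht1 => ?_⟩
  set r := Real.exp (-(c * t)) with hr
  have hr0 : 0 < r := Real.exp_pos _
  have hr1 : r < 1 := by rw [hr, Real.exp_lt_one_iff]; nlinarith
  have hrpow : ∀ k : ℕ, Real.exp (-(c * ((k : ℝ) * t))) = r ^ k := by
    intro k; rw [hr, ← Real.exp_nat_mul]; congr 1; ring
  have hgeo : t * (1 - r)⁻¹ ≤ (1 + c) / c := by
    have h1 : 1 + c * t ≤ Real.exp (c * t) := by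
      have := Real.add_one_le_exp (c * t); linarith
    have h2 : r ≤ (1 + c * t)⁻¹ := by
      rw [hr, Real.exp_neg]; exact inv_anti₀ (by positivity) h1
    have h3 : c * t / (1 + c * t) ≤ 1 - r := by
      have : c * t / (1 + c * t) = 1 - (1 + c * t)⁻¹ := by field_simp; ring
      linarith
    rw [← div_eq_mul_inv, div_le_div_iff₀ (by linarith) hc]
    have h4 : c * t ≤ (1 - r) * (1 + c * t) := (div_le_iff₀ (by positivity)).1 h3
    have h5 : (1 - r) * (1 + c * t) ≤ (1 - r) * (1 + c) :=
      mul_le_mul_of_nonneg_left (by nlinarith) (by linarith)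
    linarith
  -- per-interval identity
  have hstep : ∀ k : ℕ, (∫ u in ((k : ℝ) * t)..(((k + 1 : ℕ) : ℝ) * t), F 0 u) =
      t * F 0 (((k : ℝ) + 1) * t) + ∑ n ∈ Finset.range (M + 1),
        emC n * t ^ (n + 1) * (F n ((k : ℝ) * t) - F n (((k + 1 : ℕ) : ℝ) * t))
      + t * ∫ s in (0:ℝ)..1, bernoulliFun (M + 1) (1 - s) / ((M + 1).factorial : ℝ)
          * (t ^ (M + 1) * F (M + 1) (t * s + k * t)) := by
    intro k
    have hg : ∀ n s, HasDerivAt (fun s => t ^ n * F n (t * s + k * t))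
        (t ^ (n + 1) * F (n + 1) (t * s + k * t)) s := by
      intro n s
      have h1 : HasDerivAt (fun s : ℝ => t * s + k * t) t s := by
        simpa using ((hasDerivAt_id s).const_mul t).add_const (k * t)
      have := ((hF n (t * s + k * t)).comp s h1).const_mul (t ^ n)
      refine this.congr_deriv ?_
      ring
    have h := em_unit (fun n s => t ^ n * F n (t * s + k * t)) hg M
    have h2 := intervalIntegral.smul_integral_comp_mul_add (a := 0) (b := 1) (F 0) t (k * t)
    simp only [smul_eq_mul] at h2
    have e1 : t * 0 + k * t = k * t := by ring
    have e2 : t * 1 + k * t = ((k + 1 : ℕ) : ℝ) * t := by push_cast; ring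
    rw [e1, e2] at h2
    rw [← h2]
    simp only [pow_zero, one_mul, e1, e2] at h
    rw [h, mul_add, mul_add, Finset.mul_sum]
    congr 2
    · push_cast; rfl
    · refine Finset.sum_congr rfl fun n _ => ?_
      ring
  -- bound for remainder
  have hR : ∀ k : ℕ, |t * ∫ s in (0:ℝ)..1, bernoulliFun (M + 1) (1 - s) / ((M + 1).factorial : ℝ)
          * (t ^ (M + 1) * F (M + 1) (t * s + k * t))| ≤ t * (D * (t ^ (M + 1) * C1)) * r ^ k := by
    intro k
    rw [abs_mul, abs_of_pos ht, mul_assoc]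
    refine mul_le_mul_of_nonneg_left ?_ ht.le
    have := intervalIntegral.norm_integral_le_of_norm_le_const (a := (0:ℝ)) (b := 1)
      (C := (D * (t ^ (M + 1) * C1)) * r ^ k) (f := fun s =>
        bernoulliFun (M + 1) (1 - s) / ((M + 1).factorial : ℝ)
          * (t ^ (M + 1) * F (M + 1) (t * s + k * t))) ?_
    · simpa using this
    · intro s hs
      rw [Set.uIoc_of_le zero_le_one] at hs
      rw [norm_mul, norm_mul, norm_pow, Real.norm_of_nonneg ht.le, mul_assoc D, mul_assoc (t ^ (M + 1))]
      refine mul_le_mul (hD s ⟨hs.1.le, hs.2⟩) ?_ (by positivity) hD0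
      refine mul_le_mul_of_nonneg_left ?_ (by positivity)
      have hs0 := hs.1.le
      refine (hC1 _ (by positivity)).trans ?_
      refine mul_le_mul_of_nonneg_left ?_ hC1'
      rw [← hrpow]
      apply Real.exp_le_exp.2
      have : 0 ≤ c * (t * s) := by positivity
      linarith
  -- summability
  have hsum : Summable fun k : ℕ => F 0 (((k : ℝ) + 1) * t) := by
    refine Summable.of_norm_bounded (g := fun k : ℕ => C0 * (r ^ k * r)) ?_ ?_
    · exact ((summable_geometric_of_lt_one hr0.le hr1).mul_right r).mul_left C0
    · intro k
      have := hC0 (((k + 1 : ℕ) : ℝ) * t) (by positivity)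
      rw [hrpow, pow_succ] at this
      simpa using this
  have hfin : ∀ K : ℕ, |t * ∑ k ∈ Finset.range K, F 0 (((k : ℝ) + 1) * t)
      - (∫ u in (0:ℝ)..((K : ℝ) * t), F 0 u)
      + ∑ n ∈ Finset.range (M + 1), emC n * t ^ (n + 1) * (F n 0 - F n (K * t))|
        ≤ t * (D * (t ^ (M + 1) * C1)) * (1 - r)⁻¹ := by
    intro K
    have h1 := intervalIntegral.sum_integral_adjacent_intervals (n := K) (f := F 0)
      (μ := MeasureTheory.volume) (a := fun k : ℕ => (k : ℝ) * t)
      (fun k _ => (hcont 0).intervalIntegrable _ _)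
    simp only [Nat.cast_zero, zero_mul] at h1
    rw [← h1, Finset.sum_congr rfl fun k _ => hstep k, Finset.sum_add_distrib,
      Finset.sum_add_distrib, Finset.sum_comm]
    have h2 : ∀ n, ∑ k ∈ Finset.range K,
        emC n * t ^ (n + 1) * (F n ((k : ℝ) * t) - F n (((k + 1 : ℕ) : ℝ) * t))
        = emC n * t ^ (n + 1) * (F n 0 - F n (K * t)) := by
      intro n
      rw [← Finset.mul_sum, Finset.sum_range_sub' (fun k : ℕ => F n ((k : ℝ) * t))]
      simp
    simp only [h2]
    rw [← Finset.mul_sum]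
    have e : ∀ a b d : ℝ, a - (a + b + d) + b = -d := by intros; ring
    rw [e, abs_neg]
    refine (Finset.abs_sum_le_sum_abs _ _).trans ?_
    refine (Finset.sum_le_sum fun k _ => hR k).trans ?_
    rw [← Finset.mul_sum]
    refine mul_le_mul_of_nonneg_left ?_ (by positivity)
    rw [← tsum_geometric_of_lt_one hr0.le hr1]
    exact (summable_geometric_of_lt_one hr0.le hr1).sum_le_tsum _ (fun _ _ => by positivity)
  have hlim : |t * ∑' k : ℕ, F 0 (((k : ℝ) + 1) * t) - (∫ u in Set.Ioi (0:ℝ), F 0 u)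
      + ∑ n ∈ Finset.range (M + 1), emC n * t ^ (n + 1) * (F n 0 - 0)|
        ≤ t * (D * (t ^ (M + 1) * C1)) * (1 - r)⁻¹ := by
    refine le_of_tendsto' (Tendsto.abs (Tendsto.add (Tendsto.sub
      (hsum.hasSum.tendsto_sum_nat.const_mul t) ?_) ?_)) hfin
    · exact MeasureTheory.intervalIntegral_tendsto_integral_Ioi 0 hint
        (tendsto_natCast_atTop_atTop.atTop_mul_const ht)
    · exact tendsto_finsetSum _ fun n _ => ((htend n t ht).const_sub _).const_mul _
  rw [Finset.sum_range_succ] at hlim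
  simp only [sub_zero] at hlim
  have hlast : |emC M * t ^ (M + 1) * F M 0| = |emC M * F M 0| * t ^ (M + 1) := by
    rw [mul_right_comm, abs_mul, abs_of_pos (pow_pos ht _)]
  have hbd : t * (D * (t ^ (M + 1) * C1)) * (1 - r)⁻¹ ≤ D * C1 * ((1 + c) / c) * t ^ (M + 1) := by
    have : t * (D * (t ^ (M + 1) * C1)) * (1 - r)⁻¹ = (D * C1 * t ^ (M + 1)) * (t * (1 - r)⁻¹) := by
      ring
    rw [this]
    refine (mul_le_mul_of_nonneg_left hgeo (by positivity)).trans (le_of_eq (by ring))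
  set A := t * ∑' k : ℕ, F 0 (((k : ℝ) + 1) * t) - (∫ u in Set.Ioi (0:ℝ), F 0 u)
      + ∑ n ∈ Finset.range M, emC n * t ^ (n + 1) * F n 0 with hA
  have h3 : |A| ≤ |A + emC M * t ^ (M + 1) * F M 0| + |emC M * t ^ (M + 1) * F M 0| := by
    have := abs_sub (A + emC M * t ^ (M + 1) * F M 0) (emC M * t ^ (M + 1) * F M 0)
    simpa using this
  rw [hlast] at h3
  rw [← add_assoc] at hlim
  rw [add_mul]
  linarith

noncomputable def bphi (u : ℝ) : ℝ := dslope Real.exp 0 u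

lemma bphi_mul (u : ℝ) : u * bphi u = Real.exp u - 1 := by
  have := sub_smul_dslope Real.exp 0 u
  simpa [bphi] using this

lemma bphi_pos (u : ℝ) : 0 < bphi u := by
  rcases eq_or_ne u 0 with rfl | hu
  · simp [bphi]
  · have h := bphi_mul u
    rcases lt_or_gt_of_ne hu with h1 | h1
    · have : Real.exp u < 1 := Real.exp_lt_one_iff.2 h1
      by_contra hcon
      push Not at hcon
      nlinarith [mul_nonneg_of_nonpos_of_nonpos h1.le hcon]
    · have : 1 < Real.exp u := Real.one_lt_exp_iff.2 h1
      by_contra hcon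
      push Not at hcon
      nlinarith [mul_nonpos_of_nonneg_of_nonpos h1.le hcon]

lemma bphi_analyticAt (u : ℝ) : AnalyticAt ℝ bphi u := by
  rcases eq_or_ne u 0 with rfl | hu
  · obtain ⟨p, hp⟩ := (analyticAt_rexp : AnalyticAt ℝ Real.exp 0)
    exact ⟨_, hp.has_fpower_series_dslope_fslope⟩
  · have h : (fun v => (Real.exp v - 1) / v) =ᶠ[𝓝 u] bphi := by
      filter_upwards [isOpen_ne.mem_nhds hu] with v hv
      rw [← bphi_mul]; field_simp [show v ≠ 0 from hv]
    refine AnalyticAt.congr ?_ h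
    exact (analyticAt_rexp.sub analyticAt_const).div analyticAt_id hu

noncomputable def bh (y u : ℝ) : ℝ := Real.exp (y * u) / bphi u

lemma bh_contDiff (y : ℝ) (n : WithTop ℕ∞) : ContDiff ℝ n (bh y) := by
  rw [contDiff_iff_contDiffAt]
  intro u
  have h1 : AnalyticAt ℝ (fun u : ℝ => Real.exp (y * u)) u :=
    (analyticAt_const.mul analyticAt_id).rexp
  exact (h1.div (bphi_analyticAt u) (bphi_pos u).ne').contDiffAt

lemma bh_mul (y u : ℝ) : bh y u * (Real.exp u - 1) = u * Real.exp (y * u) := by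
  rw [← bphi_mul, bh]
  have := (bphi_pos u).ne'
  field_simp

lemma bernoulliFun_sum (n : ℕ) (y : ℝ) :
    ∑ k ∈ Finset.range (n + 1), ((n + 1).choose k : ℝ) * bernoulliFun k y = (n + 1) * y ^ n := by
  have h := congrArg (fun p => (Polynomial.map (algebraMap ℚ ℝ) p).eval y)
    (Polynomial.sum_bernoulli n)
  simp only [Polynomial.map_sum, Polynomial.eval_finsetSum, Polynomial.map_monomial,
    Polynomial.eval_monomial, Polynomial.map_smul, Polynomial.eval_smul] at h
  simpa [bernoulliFun] using h

lemma iteratedDeriv_bh_zero (y : ℝ) (n : ℕ) : iteratedDeriv n (bh y) 0 = bernoulliFun n y := by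
  induction n using Nat.strong_induction_on with
  | _ n ih =>
  have hE : ∀ k : ℕ, iteratedDeriv k (fun u : ℝ => Real.exp u - 1) 0 = if k = 0 then 0 else 1 := by
    intro k
    rcases k with _ | k
    · simp
    · rw [iteratedDeriv_succ']
      have : deriv (fun u : ℝ => Real.exp u - 1) = Real.exp := by
        funext u; simp
      rw [this, iteratedDeriv_eq_iterate, Real.iter_deriv_exp]; simp
  have hfun : (fun u => bh y u * (Real.exp u - 1)) = fun u => u * Real.exp (y * u) :=
    funext (bh_mul y)
  have hL : iteratedDeriv (n + 1) (fun u => bh y u * (Real.exp u - 1)) 0 =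
      ∑ k ∈ Finset.range (n + 1), ((n + 1).choose k : ℝ) * iteratedDeriv k (bh y) 0 := by
    rw [iteratedDeriv_fun_mul (bh_contDiff y _).contDiffAt (by fun_prop), Finset.sum_range_succ]
    simp only [hE, Nat.sub_self, if_true, mul_zero, add_zero]
    refine Finset.sum_congr rfl fun k hk => ?_
    have : n + 1 - k ≠ 0 := by have := Finset.mem_range.1 hk; omega
    simp [this]
  have hR : iteratedDeriv (n + 1) (fun u : ℝ => u * Real.exp (y * u)) 0 = (n + 1) * y ^ n := by
    rw [iteratedDeriv_fun_mul (by fun_prop) (by fun_prop),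
      Finset.sum_eq_single_of_mem 1 (by simp)]
    · simp [iteratedDeriv_fun_id_zero]
    · intro b _ hb
      simp [iteratedDeriv_fun_id_zero, hb]
  rw [hfun, hR, ← bernoulliFun_sum, Finset.sum_range_succ, Finset.sum_range_succ] at hL
  have hS : ∑ k ∈ Finset.range n, ((n + 1).choose k : ℝ) * iteratedDeriv k (bh y) 0 =
      ∑ k ∈ Finset.range n, ((n + 1).choose k : ℝ) * bernoulliFun k y :=
    Finset.sum_congr rfl fun k hk => by rw [ih k (Finset.mem_range.1 hk)]
  rw [hS] at hL
  have h2 : (((n + 1).choose n : ℕ) : ℝ) ≠ 0 := by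
    rw [Nat.choose_succ_self_right]; positivity
  exact (mul_left_cancel₀ h2 (add_left_cancel hL)).symm

noncomputable def bf (p : ℕ) (x u : ℝ) : ℝ := u ^ p * bh (1 - x) u

lemma bf_contDiff (p : ℕ) (x : ℝ) (n : WithTop ℕ∞) : ContDiff ℝ n (bf p x) :=
  (contDiff_id.pow p).mul (bh_contDiff _ n)

lemma bf_eq (p : ℕ) (x : ℝ) {u : ℝ} (hu : 0 < u) :
    bf p x u = u ^ (p + 1) * Real.exp (-(x * u)) * (1 - Real.exp (-u))⁻¹ := by
  have h1 : Real.exp (-u) < 1 := by rw [Real.exp_lt_one_iff]; linarith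
  have h2 : (1 - Real.exp (-u)) ≠ 0 := by linarith
  have h3 := bh_mul (1 - x) u
  have h4 : Real.exp u - 1 = Real.exp u * (1 - Real.exp (-u)) := by
    rw [mul_sub, ← Real.exp_add]; simp
  have h5 : Real.exp ((1 - x) * u) = Real.exp u * Real.exp (-(x * u)) := by
    rw [← Real.exp_add]; congr 1; ring
  rw [h4, h5] at h3
  have h6 : bh (1 - x) u * (1 - Real.exp (-u)) = u * Real.exp (-(x * u)) := by
    apply mul_left_cancel₀ (Real.exp_pos u).ne'
    linarith
  rw [bf, eq_mul_inv_iff_mul_eq₀ h2, mul_assoc, h6]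
  ring

lemma iteratedDeriv_bf_zero_lt (p : ℕ) (x : ℝ) (n : ℕ) (hn : n < p) :
    iteratedDeriv n (bf p x) 0 = 0 := by
  unfold bf
  rw [iteratedDeriv_fun_mul (by fun_prop) (bh_contDiff _ _).contDiffAt]
  refine Finset.sum_eq_zero fun i hi => ?_
  have : i ≠ p := by have := Finset.mem_range.1 hi; omega
  rw [iteratedDeriv_fun_pow_zero]
  simp [this]

lemma iteratedDeriv_bf_zero (p : ℕ) (x : ℝ) (k : ℕ) :
    iteratedDeriv (p + k) (bf p x) 0 =
      ((p + k).factorial : ℝ) / (k.factorial : ℝ) * ((-1) ^ k * bernoulliFun k x) := by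
  unfold bf
  rw [iteratedDeriv_fun_mul (by fun_prop) (bh_contDiff _ _).contDiffAt,
    Finset.sum_eq_single_of_mem p (by simp)]
  · rw [iteratedDeriv_fun_pow_zero, if_pos rfl, Nat.add_sub_cancel_left, iteratedDeriv_bh_zero,
      bernoulliFun_eval_one_sub, Nat.choose_symm_add, Nat.add_choose]
    congr 1
    rw [Nat.cast_div (Nat.factorial_mul_factorial_dvd_factorial_add p k) (by positivity)]
    push_cast
    field_simp
  · intro b _ hb
    rw [iteratedDeriv_fun_pow_zero]
    simp [hb]

/-- The class of functions closed under derivative, decaying exponentially. -/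
inductive BCl (x : ℝ) : (ℝ → ℝ) → Prop
  | basic (a c : ℕ) (b : ℝ) (hb : x ≤ b) :
      BCl x (fun u => u ^ a * Real.exp (-(b * u)) * (1 - Real.exp (-u))⁻¹ ^ c)
  | add (f g : ℝ → ℝ) : BCl x f → BCl x g → BCl x (fun u => f u + g u)
  | smul (r : ℝ) (f : ℝ → ℝ) : BCl x f → BCl x (fun u => r * f u)

lemma BCl.deriv_mem {x : ℝ} {f : ℝ → ℝ} (hf : BCl x f) :
    ∃ g, BCl x g ∧ ∀ u, 0 < u → HasDerivAt f (g u) u := by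
  induction hf with
  | basic a c b hb =>
    refine ⟨_, BCl.add _ _ (BCl.add _ _
      (BCl.smul a _ (BCl.basic (a - 1) c b hb)) (BCl.smul (-b) _ (BCl.basic a c b hb)))
      (BCl.smul (-c) _ (BCl.basic a (c + 1) (b + 1) (by linarith))), fun u hu => ?_⟩
    have h1 : Real.exp (-u) < 1 := by rw [Real.exp_lt_one_iff]; linarith
    have h2 : (1 - Real.exp (-u)) ≠ 0 := by linarith
    have d1 : HasDerivAt (fun u : ℝ => u ^ a) (a * u ^ (a - 1)) u := hasDerivAt_pow a u
    have d2 : HasDerivAt (fun u : ℝ => Real.exp (-(b * u))) (Real.exp (-(b * u)) * (-b)) u := by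
      have : HasDerivAt (fun u : ℝ => -(b * u)) (-b) u := by
        have h := ((hasDerivAt_id u).const_mul b).neg
        exact h.congr_deriv (by simp)
      exact this.exp
    have d3 : HasDerivAt (fun u : ℝ => 1 - Real.exp (-u)) (Real.exp (-u)) u := by
      have := ((hasDerivAt_id u).neg.exp).const_sub 1
      simpa using this
    have d4 := (d3.inv h2).pow c
    have d5 := (d1.mul d2).mul d4
    refine d5.congr_deriv ?_
    have e : Real.exp (-((b + 1) * u)) = Real.exp (-(b * u)) * Real.exp (-u) := by
      rw [← Real.exp_add]; congr 1; ring
    rw [e]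
    simp only [Pi.mul_apply, Pi.pow_apply, Pi.inv_apply]
    rcases c with _ | c
    · simp; ring
    · simp only [Nat.add_sub_cancel, div_eq_mul_inv, ← inv_pow]
      ring
  | add f g _ _ ihf ihg =>
    obtain ⟨f', hf', hf''⟩ := ihf
    obtain ⟨g', hg', hg''⟩ := ihg
    exact ⟨_, BCl.add _ _ hf' hg', fun u hu => (hf'' u hu).add (hg'' u hu)⟩
  | smul r f _ ihf =>
    obtain ⟨f', hf', hf''⟩ := ihf
    exact ⟨_, BCl.smul r _ hf', fun u hu => (hf'' u hu).const_mul r⟩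

lemma BCl.bound {x : ℝ} (hx : 0 < x) {f : ℝ → ℝ} (hf : BCl x f) :
    ∃ C, ∀ u, 1 ≤ u → |f u| ≤ C * Real.exp (-(x / 2 * u)) := by
  induction hf with
  | basic a c b hb =>
    -- `u ^ a ≤ a! (2/x)^a exp (x/2 u)`
    refine ⟨(a.factorial : ℝ) / (x / 2) ^ a * (1 - Real.exp (-1))⁻¹ ^ c, fun u hu => ?_⟩
    have hu0 : 0 < u := by linarith
    have h1 : Real.exp (-u) ≤ Real.exp (-1) := Real.exp_le_exp.2 (by linarith)
    have h0 : Real.exp (-1) < 1 := by rw [Real.exp_lt_one_iff]; linarith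
    have h2 : (1 - Real.exp (-u))⁻¹ ≤ (1 - Real.exp (-1))⁻¹ :=
      inv_anti₀ (by linarith) (by linarith)
    have h2' : 0 < (1 - Real.exp (-u))⁻¹ := inv_pos.2 (by linarith)
    have h3 : u ^ a ≤ (a.factorial : ℝ) / (x / 2) ^ a * Real.exp (x / 2 * u) := by
      have := Real.pow_div_factorial_le_exp (x / 2 * u) (by positivity) a
      rw [mul_pow] at this
      rw [div_mul_eq_mul_div, le_div_iff₀ (by positivity)]
      rw [div_le_iff₀ (by positivity)] at this
      linarith
    rw [abs_of_nonneg (by positivity)]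
    have h4 : Real.exp (-(b * u)) ≤ Real.exp (-(x / 2 * u)) * Real.exp (-(x / 2 * u)) := by
      rw [← Real.exp_add]
      exact Real.exp_le_exp.2 (by nlinarith)
    have h5 : Real.exp (x / 2 * u) * Real.exp (-(x / 2 * u)) = 1 := by
      rw [← Real.exp_add]; simp
    calc u ^ a * Real.exp (-(b * u)) * (1 - Real.exp (-u))⁻¹ ^ c
        ≤ ((a.factorial : ℝ) / (x / 2) ^ a * Real.exp (x / 2 * u)) *
          (Real.exp (-(x / 2 * u)) * Real.exp (-(x / 2 * u))) * (1 - Real.exp (-1))⁻¹ ^ c := by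
          gcongr
      _ = (a.factorial : ℝ) / (x / 2) ^ a * (1 - Real.exp (-1))⁻¹ ^ c * Real.exp (-(x / 2 * u)) *
          (Real.exp (x / 2 * u) * Real.exp (-(x / 2 * u))) := by ring
      _ = _ := by rw [h5, mul_one]
  | add f g _ _ ihf ihg =>
    obtain ⟨C, hC⟩ := ihf
    obtain ⟨D, hD⟩ := ihg
    refine ⟨C + D, fun u hu => ?_⟩
    have := abs_add_le (f u) (g u)
    have := hC u hu
    have := hD u hu
    rw [add_mul]; linarith
  | smul r f _ ihf =>
    obtain ⟨C, hC⟩ := ihf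
    refine ⟨|r| * C, fun u hu => ?_⟩
    rw [abs_mul, mul_assoc]
    exact mul_le_mul_of_nonneg_left (hC u hu) (abs_nonneg r)

lemma iteratedDeriv_bf_BCl (p : ℕ) (x : ℝ) (n : ℕ) :
    ∃ g, BCl x g ∧ ∀ u, 0 < u → iteratedDeriv n (bf p x) u = g u := by
  induction n with
  | zero =>
    refine ⟨_, BCl.basic (p + 1) 1 x le_rfl, fun u hu => ?_⟩
    simp [bf_eq p x hu]
  | succ n ih =>
    obtain ⟨g, hg, h⟩ := ih
    obtain ⟨g', hg', h'⟩ := hg.deriv_mem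
    refine ⟨g', hg', fun u hu => ?_⟩
    rw [iteratedDeriv_succ]
    have : iteratedDeriv n (bf p x) =ᶠ[𝓝 u] g := by
      filter_upwards [isOpen_Ioi.mem_nhds hu] with v hv using h v hv
    rw [this.deriv_eq, (h' u hu).deriv]

lemma iteratedDeriv_bf_bound (p : ℕ) (x : ℝ) (hx : 0 < x) (n : ℕ) :
    ∃ C, ∀ u, 0 ≤ u → |iteratedDeriv n (bf p x) u| ≤ C * Real.exp (-(x / 2 * u)) := by
  obtain ⟨g, hg, h⟩ := iteratedDeriv_bf_BCl p x n
  obtain ⟨C, hC⟩ := hg.bound hx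
  have hcont : Continuous (iteratedDeriv n (bf p x)) :=
    (bf_contDiff p x n).continuous_iteratedDeriv n le_rfl
  obtain ⟨D, hD⟩ := (isCompact_Icc (a := (0:ℝ)) (b := 1)).exists_bound_of_continuousOn
    hcont.continuousOn
  refine ⟨max C (D * Real.exp (x / 2)), fun u hu => ?_⟩
  rcases le_total 1 u with h1 | h1
  · rw [h u (by linarith)]
    refine (hC u h1).trans ?_
    gcongr
    exact le_max_left _ _
  · have hD' := hD u ⟨hu, h1⟩
    have hD0 : 0 ≤ D := (norm_nonneg _).trans hD'
    rw [Real.norm_eq_abs] at hD'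
    have h3 : 1 ≤ Real.exp (x / 2) * Real.exp (-(x / 2 * u)) := by
      rw [← Real.exp_add]; exact Real.one_le_exp (by nlinarith)
    calc _ ≤ D := hD'
      _ ≤ D * (Real.exp (x / 2) * Real.exp (-(x / 2 * u))) := le_mul_of_one_le_right hD0 h3
      _ = D * Real.exp (x / 2) * Real.exp (-(x / 2 * u)) := by ring
      _ ≤ _ := by gcongr; exact le_max_right _ _

lemma iteratedDeriv_bf_hasDerivAt (p : ℕ) (x : ℝ) (n : ℕ) (u : ℝ) :
    HasDerivAt (iteratedDeriv n (bf p x)) (iteratedDeriv (n + 1) (bf p x) u) u := by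
  rw [iteratedDeriv_succ]
  exact (((bf_contDiff p x ⊤).differentiable_iteratedDeriv n (by exact_mod_cast WithTop.coe_lt_top _)) u).hasDerivAt

noncomputable def zS (j : ℕ) (y : ℝ) : ℝ := ∑' n : ℕ, ((y + n) ^ j)⁻¹

lemma zS_summable (j : ℕ) (hj : 2 ≤ j) (y : ℝ) (hy : 0 < y) :
    Summable fun n : ℕ => ((y + n) ^ j)⁻¹ := by
  rw [← summable_nat_add_iff 1]
  have h : Summable fun n : ℕ => (((n + 1 : ℕ) : ℝ) ^ 2)⁻¹ :=
    (summable_nat_add_iff 1).2 (Real.summable_nat_pow_inv.2 (by norm_num))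
  refine Summable.of_nonneg_of_le (fun n => by positivity) (fun n => ?_) h
  have h1 : (1 : ℝ) ≤ ((n + 1 : ℕ) : ℝ) := by push_cast; linarith [Nat.cast_nonneg (α := ℝ) n]
  apply inv_anti₀ (by positivity)
  calc (((n + 1 : ℕ) : ℝ) ^ 2) ≤ ((n + 1 : ℕ) : ℝ) ^ j := pow_le_pow_right₀ h1 hj
    _ ≤ (y + ((n + 1 : ℕ) : ℝ)) ^ j := by gcongr; linarith

lemma hasDerivAt_inv_pow (j : ℕ) (c y : ℝ) (h : y + c ≠ 0) :
    HasDerivAt (fun y : ℝ => ((y + c) ^ j)⁻¹) (-(j : ℝ) * ((y + c) ^ (j + 1))⁻¹) y := by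
  have h1 : HasDerivAt (fun y : ℝ => y + c) 1 y := (hasDerivAt_id y).add_const c
  have h2 := (h1.pow j).inv (pow_ne_zero j h)
  refine h2.congr_deriv ?_
  rcases j with _ | j
  · simp
  · simp only [Nat.add_sub_cancel, Pi.pow_apply]
    field_simp
    ring

lemma zS_hasDerivAt (j : ℕ) (hj : 2 ≤ j) (y : ℝ) (hy : 0 < y) :
    HasDerivAt (zS j) (-(j : ℝ) * zS (j + 1) y) y := by
  have h := hasDerivAt_tsum_of_isPreconnected (𝕜 := ℝ) (F := ℝ) (t := Set.Ioi (y / 2))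
    (g := fun (n : ℕ) y => ((y + n) ^ j)⁻¹)
    (g' := fun (n : ℕ) y => -(j : ℝ) * ((y + n) ^ (j + 1))⁻¹) (y₀ := y) (y := y)
    (u := fun n : ℕ => (j : ℝ) * ((y / 2 + n) ^ (j + 1))⁻¹)
    ((zS_summable (j + 1) (by omega) (y / 2) (by positivity)).mul_left _) isOpen_Ioi
    isPreconnected_Ioi ?_ ?_ (by simpa using hy) (zS_summable j hj y hy) (by simpa using hy)
  · rw [tsum_mul_left] at h
    exact h
  · intro n z hz
    have hz : y / 2 < z := hz
    have : 0 < z := by linarith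
    exact hasDerivAt_inv_pow j n z (by positivity)
  · intro n z hz
    have hz : y / 2 < z := hz
    have : 0 < z := by linarith
    rw [norm_mul, norm_neg, Real.norm_of_nonneg (by positivity), Real.norm_of_nonneg (by positivity)]
    gcongr

noncomputable def lgT (n : ℕ) (y : ℝ) : ℝ :=
  y * (Real.log (n + 2) - Real.log (n + 1)) + Real.log (n + 2) - Real.log (y + (n + 2))

noncomputable def lgT' (n : ℕ) (y : ℝ) : ℝ :=
  (Real.log (n + 2) - Real.log (n + 1)) - (y + (n + 2))⁻¹

lemma lgT_hasDerivAt (n : ℕ) (y : ℝ) (hy : 0 < y) : HasDerivAt (lgT n) (lgT' n y) y := by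
  have h1 : HasDerivAt (fun y : ℝ => y + ((n : ℝ) + 2)) 1 y := (hasDerivAt_id y).add_const _
  have h2 := h1.log (by positivity)
  have h3 := (((hasDerivAt_id y).mul_const (Real.log (n + 2) - Real.log (n + 1))).add_const
    (Real.log (n + 2))).sub h2
  refine h3.congr_deriv ?_
  simp [lgT']

lemma lgT_sum (y : ℝ) (K : ℕ) : ∑ n ∈ Finset.range K, lgT n y =
    Real.BohrMollerup.logGammaSeq y (K + 1) - Real.BohrMollerup.logGammaSeq y 1 := by
  rw [← Finset.sum_range_sub (fun K => Real.BohrMollerup.logGammaSeq y (K + 1))]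
  refine Finset.sum_congr rfl fun n _ => ?_
  unfold Real.BohrMollerup.logGammaSeq lgT
  rw [Finset.sum_range_succ _ (n + 1 + 1), Nat.factorial_succ (n + 1)]
  push_cast
  rw [Real.log_mul (by positivity) (by positivity)]
  have e : (n : ℝ) + 1 + 1 = n + 2 := by ring
  rw [e]
  ring

lemma lgT_tendsto (y : ℝ) (hy : 0 < y) :
    Tendsto (fun K => ∑ n ∈ Finset.range K, lgT n y) atTop
      (𝓝 (Real.log (Real.Gamma y) - Real.BohrMollerup.logGammaSeq y 1)) := by
  simp only [lgT_sum]
  exact ((Real.BohrMollerup.tendsto_log_gamma hy).comp (tendsto_add_atTop_nat 1)).sub_const _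

lemma lgT_one_summable : Summable fun n => lgT n 1 := by
  refine ((hasSum_iff_tendsto_nat_of_nonneg (fun n => ?_) _).2
    (lgT_tendsto 1 one_pos)).summable
  unfold lgT
  have h : Real.log (((n : ℝ) + 1) * (1 + (n + 2))) ≤ Real.log (((n : ℝ) + 2) * (n + 2)) :=
    Real.log_le_log (by positivity) (by nlinarith)
  rw [Real.log_mul (by positivity) (by positivity), Real.log_mul (by positivity) (by positivity)] at h
  linarith

lemma lgT'_bound (b : ℝ) (n : ℕ) (y : ℝ) (hy : 0 < y) (hyb : y < b) :
    ‖lgT' n y‖ ≤ (1 + b) * (((n + 1 : ℕ) : ℝ) ^ 2)⁻¹ := by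
  have hb : 0 < b := hy.trans hyb
  have hn : (0:ℝ) ≤ n := Nat.cast_nonneg n
  have e : Real.log (n + 2) - Real.log (n + 1) = Real.log (((n : ℝ) + 2) / (n + 1)) :=
    (Real.log_div (by positivity) (by positivity)).symm
  have h1 : Real.log (((n : ℝ) + 2) / (n + 1)) ≤ ((n : ℝ) + 1)⁻¹ := by
    have := Real.log_le_sub_one_of_pos (x := ((n : ℝ) + 2) / (n + 1)) (by positivity)
    have e : ((n : ℝ) + 2) / (n + 1) - 1 = ((n : ℝ) + 1)⁻¹ := by field_simp; ring
    linarith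
  have h2 : ((n : ℝ) + 2)⁻¹ ≤ Real.log (((n : ℝ) + 2) / (n + 1)) := by
    have := Real.one_sub_inv_le_log_of_pos (x := ((n : ℝ) + 2) / (n + 1)) (by positivity)
    have e : 1 - (((n : ℝ) + 2) / (n + 1))⁻¹ = ((n : ℝ) + 2)⁻¹ := by field_simp; ring
    linarith
  have h3 : (y + (n + 2))⁻¹ ≤ ((n : ℝ) + 2)⁻¹ := inv_anti₀ (by positivity) (by linarith)
  have h4 : (b + (n + 2))⁻¹ ≤ (y + ((n : ℝ) + 2))⁻¹ := inv_anti₀ (by positivity) (by linarith)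
  have h5 : ((n : ℝ) + 1)⁻¹ - (b + (n + 2))⁻¹ ≤ (1 + b) * (((n : ℝ) + 1) ^ 2)⁻¹ := by
    have : ((n : ℝ) + 1)⁻¹ - (b + (n + 2))⁻¹ = (1 + b) * (((n : ℝ) + 1) * (b + (n + 2)))⁻¹ := by
      field_simp; ring
    rw [this]
    gcongr
    nlinarith
  unfold lgT'
  rw [e, Real.norm_of_nonneg (by linarith)]
  push_cast
  linarith

lemma sq_summable (b : ℝ) : Summable fun n : ℕ => (1 + b) * (((n + 1 : ℕ) : ℝ) ^ 2)⁻¹ :=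
  ((summable_nat_add_iff 1).2 (Real.summable_nat_pow_inv.2 (by norm_num))).mul_left _

lemma logGamma_eq (y : ℝ) (hy : 0 < y) :
    Real.log (Real.Gamma y) = (-Real.log y - Real.log (y + 1)) + ∑' n, lgT n y := by
  have hs : Summable fun n => lgT n y := by
    refine summable_of_summable_hasDerivAt_of_isPreconnected (𝕜 := ℝ) (F := ℝ)
      (t := Set.Ioo 0 (y + 2))
      (g := lgT) (g' := lgT') (y₀ := 1) (sq_summable (y + 2)) isOpen_Ioo isPreconnected_Ioo
      (fun n z hz => lgT_hasDerivAt n z hz.1) (fun n z hz => lgT'_bound _ n z hz.1 hz.2)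
      ⟨by norm_num, by linarith⟩ lgT_one_summable ⟨hy, by linarith⟩
  have h := tendsto_nhds_unique hs.hasSum.tendsto_sum_nat (lgT_tendsto y hy)
  rw [h]
  simp [Real.BohrMollerup.logGammaSeq, Finset.sum_range_succ]
  ring

lemma logGamma_deriv (y : ℝ) (hy : 0 < y) :
    HasDerivAt (fun y => Real.log (Real.Gamma y)) ((-y⁻¹ - (y + 1)⁻¹) + ∑' n, lgT' n y) y := by
  have h := hasDerivAt_tsum_of_isPreconnected (𝕜 := ℝ) (F := ℝ)
      (t := Set.Ioo 0 (y + 2))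
      (g := lgT) (g' := lgT') (y₀ := 1) (sq_summable (y + 2)) isOpen_Ioo isPreconnected_Ioo
      (fun n z hz => lgT_hasDerivAt n z hz.1) (fun n z hz => lgT'_bound _ n z hz.1 hz.2)
      ⟨by norm_num, by linarith⟩ lgT_one_summable (y := y) ⟨hy, by linarith⟩
  have h1 : HasDerivAt (fun y : ℝ => Real.log (y + 1)) (1 / (y + 1)) y :=
    ((hasDerivAt_id y).add_const 1).log (by simp; linarith)
  have h2 := (((Real.hasDerivAt_log hy.ne').neg).sub h1).add h
  have h3 : (fun y => Real.log (Real.Gamma y)) =ᶠ[𝓝 y]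
      fun y => (-Real.log y - Real.log (y + 1)) + ∑' n, lgT n y := by
    filter_upwards [isOpen_Ioi.mem_nhds hy] with z hz using logGamma_eq z hz
  refine HasDerivAt.congr_of_eventuallyEq ?_ h3
  refine h2.congr_deriv ?_
  simp

lemma logGamma_deriv2 (y : ℝ) (hy : 0 < y) :
    HasDerivAt (fun y : ℝ => (-y⁻¹ - (y + 1)⁻¹) + ∑' n, lgT' n y) (zS 2 y) y := by
  have hs : Summable fun n => lgT' n y :=
    Summable.of_norm_bounded (sq_summable (y + 1)) fun n => lgT'_bound _ n y hy (by linarith)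
  have h := hasDerivAt_tsum_of_isPreconnected (𝕜 := ℝ) (F := ℝ)
      (t := Set.Ioi 0)
      (g := lgT') (g' := fun n y => ((y + (n + 2)) ^ 2)⁻¹) (y₀ := y) (sq_summable 0) isOpen_Ioi
      isPreconnected_Ioi
      (fun n z hz => ?_) (fun n z hz => ?_) hy hs (y := y) hy
  · have h0 : HasDerivAt (fun y : ℝ => y⁻¹) (-(y ^ 2)⁻¹) y := hasDerivAt_inv hy.ne'
    have h1 : HasDerivAt (fun y : ℝ => (y + 1)⁻¹) (-((y + 1) ^ 2)⁻¹) y := by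
      simpa using hasDerivAt_inv_pow 1 1 y (by positivity)
    have h2 := (h0.neg.sub h1).add h
    refine h2.congr_deriv ?_
    unfold zS
    rw [← (zS_summable 2 le_rfl y hy).sum_add_tsum_nat_add 2]
    simp [Finset.sum_range_succ]
  · have hz : 0 < z := hz
    have := (hasDerivAt_inv_pow 1 (n + 2) z (by positivity)).const_sub
      (Real.log (n + 2) - Real.log (n + 1))
    refine HasDerivAt.congr_deriv (f' := _) (f := lgT' n) (HasDerivAt.congr_of_eventuallyEq this
      (Eventually.of_forall fun w => ?_)) ?_
    · simp [lgT']
    · simp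
  · have hz : 0 < z := hz
    rw [Real.norm_of_nonneg (by positivity)]
    simp only [add_zero, one_mul]
    push_cast
    have hn : (0:ℝ) ≤ n := Nat.cast_nonneg n
    exact inv_anti₀ (by positivity) (pow_le_pow_left₀ (by positivity) (by linarith) 2)

lemma polygamma_eq_zS (m : ℕ) (hm : 1 ≤ m) : ∀ y : ℝ, 0 < y →
    polygamma m y = (-1) ^ (m + 1) * (m.factorial : ℝ) * zS (m + 1) y := by
  unfold polygamma
  induction m, hm using Nat.le_induction with
  | base =>
    intro y hy
    rw [iteratedDeriv_succ, iteratedDeriv_one]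
    have : deriv (fun y => Real.log (Real.Gamma y)) =ᶠ[𝓝 y]
        fun y : ℝ => (-y⁻¹ - (y + 1)⁻¹) + ∑' n, lgT' n y := by
      filter_upwards [isOpen_Ioi.mem_nhds hy] with z hz using (logGamma_deriv z hz).deriv
    rw [this.deriv_eq, (logGamma_deriv2 y hy).deriv]
    simp
  | succ m hm ih =>
    intro y hy
    rw [iteratedDeriv_succ]
    have : iteratedDeriv (m + 1) (fun y => Real.log (Real.Gamma y)) =ᶠ[𝓝 y]
        fun y : ℝ => (-1) ^ (m + 1) * (m.factorial : ℝ) * zS (m + 1) y := by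
      filter_upwards [isOpen_Ioi.mem_nhds hy] with z hz using ih z hz
    rw [this.deriv_eq, ((zS_hasDerivAt (m + 1) (by omega) y hy).const_mul _).deriv,
      Nat.factorial_succ m]
    push_cast
    ring

lemma integral_pow_exp (m : ℕ) (a : ℝ) (ha : 0 < a) :
    ∫ u in Set.Ioi (0:ℝ), u ^ m * Real.exp (-(a * u)) = (m.factorial : ℝ) * (a ^ (m + 1))⁻¹ := by
  have h := Real.integral_rpow_mul_exp_neg_mul_Ioi (a := (m : ℝ) + 1) (r := a) (by positivity) ha
  simp only [add_sub_cancel_right, Real.rpow_natCast, Real.Gamma_nat_eq_factorial] at h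
  rw [h]
  have : (1 / a) ^ ((m : ℝ) + 1) = (a ^ (m + 1))⁻¹ := by
    rw [one_div, ← inv_pow, ← Real.rpow_natCast]; push_cast; rfl
  rw [this, mul_comm]

lemma integral_bf (p : ℕ) (x : ℝ) (hx : 0 < x) :
    ∫ u in Set.Ioi (0:ℝ), bf p x u = ((p + 1).factorial : ℝ) * zS (p + 2) x := by
  have hI : ∀ n : ℕ, MeasureTheory.IntegrableOn
      (fun u : ℝ => u ^ (p + 1) * Real.exp (-((x + n) * u))) (Set.Ioi 0) := by
    intro n
    by_contra hcon
    have h1 := MeasureTheory.integral_undef hcon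
    have h2 := integral_pow_exp (p + 1) (x + n) (by positivity)
    rw [h2] at h1
    have : (0:ℝ) < ((p + 1).factorial : ℝ) * ((x + n) ^ (p + 1 + 1))⁻¹ := by positivity
    linarith
  have h := MeasureTheory.hasSum_integral_of_summable_integral_norm
    (F := fun (n : ℕ) (u : ℝ) => u ^ (p + 1) * Real.exp (-((x + n) * u))) hI ?_
  · have e1 : ∫ u in Set.Ioi (0:ℝ), bf p x u =
        ∫ u in Set.Ioi (0:ℝ), ∑' n : ℕ, u ^ (p + 1) * Real.exp (-((x + n) * u)) := by
      refine MeasureTheory.setIntegral_congr_fun measurableSet_Ioi fun u hu => ?_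
      have hu : 0 < u := hu
      have h1 : Real.exp (-u) < 1 := by rw [Real.exp_lt_one_iff]; linarith
      show bf p x u = ∑' n : ℕ, u ^ (p + 1) * Real.exp (-((x + n) * u))
      rw [bf_eq p x hu, ← tsum_geometric_of_lt_one (Real.exp_pos _).le h1, ← tsum_mul_left]
      refine tsum_congr fun n => ?_
      rw [mul_assoc, ← Real.exp_nat_mul, ← Real.exp_add]
      congr 2
      ring
    rw [e1, ← h.tsum_eq, zS, ← tsum_mul_left]
    exact tsum_congr fun n => integral_pow_exp (p + 1) (x + n) (by positivity)
  · have e2 : ∀ n : ℕ, ∫ u in Set.Ioi (0:ℝ), ‖u ^ (p + 1) * Real.exp (-((x + n) * u))‖ =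
        ((p + 1).factorial : ℝ) * ((x + n) ^ (p + 2))⁻¹ := by
      intro n
      rw [← integral_pow_exp (p + 1) (x + n) (by positivity)]
      refine MeasureTheory.setIntegral_congr_fun measurableSet_Ioi fun u hu => ?_
      have hu : 0 < u := hu
      exact Real.norm_of_nonneg (by positivity)
    simp only [e2]
    exact (zS_summable (p + 2) (by omega) x hx).mul_left _

lemma emC_zeta (n : ℕ) : riemannZeta (-(n : ℂ)) = ((-(emC n * (n.factorial : ℝ)) : ℝ) : ℂ) := by
  rw [riemannZeta_neg_nat_eq_bernoulli']
  have h : bernoulliFun (n + 1) 1 = (bernoulli' (n + 1) : ℝ) := by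
    rw [bernoulliFun, Polynomial.eval_one_map, Polynomial.bernoulli_eval_one, eq_ratCast]
  rw [emC, h, Nat.factorial_succ]
  have h1 : (n.factorial : ℂ) ≠ 0 := by exact_mod_cast n.factorial_ne_zero
  have h2 : (n : ℂ) + 1 ≠ 0 := by exact_mod_cast n.succ_ne_zero
  push_cast
  field_simp

lemma qPolygamma_eq (p : ℕ) (x q : ℝ) (hq0 : 0 < q) (hq1 : q < 1) :
    qPolygamma q (p + 1) x = (-1) ^ (p + 2) *
      (-Real.log q * ∑' k : ℕ, bf p x (((k : ℝ) + 1) * (-Real.log q))) := by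
  have ht : 0 < -Real.log q := by have := Real.log_neg hq0 hq1; linarith
  set t := -Real.log q with htd
  have hL : Real.log q = -t := by rw [htd]; ring
  have hq : q = Real.exp (-t) := by rw [← hL, Real.exp_log hq0]
  unfold qPolygamma
  have h : ∀ k : ℕ, bf p x (((k : ℝ) + 1) * t) = t ^ (p + 1) *
      (((k : ℝ) + 1) ^ (p + 1) * q ^ (((k : ℝ) + 1) * x) / (1 - q ^ (k + 1))) := by
    intro k
    rw [bf_eq p x (by positivity), Real.rpow_def_of_pos hq0, hL]
    have e1 : q ^ (k + 1) = Real.exp (-(((k : ℝ) + 1) * t)) := by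
      rw [hq, ← Real.exp_nat_mul]; congr 1; push_cast; ring
    have e2 : -t * (((k : ℝ) + 1) * x) = -(x * (((k : ℝ) + 1) * t)) := by ring
    rw [e1, e2, mul_pow]
    ring
  simp only [h, tsum_mul_left]
  rw [hL, neg_pow]
  ring

/-- Asymptotic expansion of the q-polygamma function near `q = 1`:
for `m ≥ 1`,
`ψ_q^{(m)}(x) = ψ^{(m)}(x) − ∑_{k=0}^N (ζ(1-m-k)/k!) B_k(x) (log q)^{m+k}
  + O((log(1/q))^{m+N+1})`. -/
theorem qPolygamma_asymptotic (m : ℕ) (hm : 1 ≤ m)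
    (x : ℝ) (hx0 : 0 < x) (hx1 : x ≤ 1) (N : ℕ) :
    (fun q : ℝ =>
        ((qPolygamma q m x : ℝ) : ℂ)
        - (((polygamma m x : ℝ) : ℂ)
            - ∑ k ∈ Finset.range (N + 1),
                riemannZeta (1 - (m : ℂ) - (k : ℂ)) / (Nat.factorial k : ℂ) *
                  ((Polynomial.aeval x (Polynomial.bernoulli k) : ℝ) : ℂ) *
                  ((Real.log q : ℂ)) ^ (m + k)))
      =O[𝓝[Set.Ioo (0 : ℝ) 1] 1] fun q : ℝ => (Real.log (1 / q)) ^ (m + N + 1) := by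
  obtain ⟨p, rfl⟩ : ∃ p, m = p + 1 := ⟨m - 1, by omega⟩
  obtain ⟨C, hC⟩ := em_asymp (fun n => iteratedDeriv n (bf p x))
    (iteratedDeriv_bf_hasDerivAt p x) (x / 2) (by positivity) (iteratedDeriv_bf_bound p x hx0)
    (p + (N + 1))
  refine IsBigO.of_bound C ?_
  have hnear : ∀ᶠ q : ℝ in 𝓝[Set.Ioo (0 : ℝ) 1] 1, Real.exp (-1) < q :=
    mem_nhdsWithin_of_mem_nhds (isOpen_Ioi.mem_nhds (by
      show Real.exp (-1) < 1
      rw [Real.exp_lt_one_iff]; norm_num))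
  filter_upwards [hnear, self_mem_nhdsWithin] with q hq1 hq
  have ht : 0 < -Real.log q := by have := Real.log_neg hq.1 hq.2; linarith
  have ht1 : -Real.log q < 1 := by
    have := (Real.lt_log_iff_exp_lt hq.1).2 hq1; linarith
  have key := hC _ ht ht1
  rw [polygamma_eq_zS (p + 1) (by omega) x hx0, qPolygamma_eq p x q hq.1 hq.2]
  simp only [iteratedDeriv_zero] at key
  rw [integral_bf p x hx0, Finset.sum_range_add, Finset.sum_eq_zero (s := Finset.range p), zero_add]
    at key
  swap
  · intro n hn
    rw [iteratedDeriv_bf_zero_lt p x n (Finset.mem_range.1 hn), mul_zero]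
  set t := -Real.log q with htd
  have hL : Real.log q = -t := by rw [htd]; ring
  have hterm : ∀ k : ℕ, riemannZeta (1 - ((p + 1 : ℕ) : ℂ) - (k : ℂ)) / (Nat.factorial k : ℂ) *
      ((Polynomial.aeval x (Polynomial.bernoulli k) : ℝ) : ℂ) *
      ((Real.log q : ℂ)) ^ (p + 1 + k) =
      (((-1) ^ (p + 2) * (emC (p + k) * t ^ (p + k + 1) * iteratedDeriv (p + k) (bf p x) 0) : ℝ) : ℂ)
      := by
    intro k
    have e1 : (1 : ℂ) - ((p + 1 : ℕ) : ℂ) - (k : ℂ) = -((p + k : ℕ) : ℂ) := by push_cast; ring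
    have e2 : (Polynomial.aeval x (Polynomial.bernoulli k) : ℝ) = bernoulliFun k x := by
      rw [bernoulliFun, Polynomial.eval_map_algebraMap]
    rw [e1, e2, emC_zeta, iteratedDeriv_bf_zero, hL]
    norm_cast
    rw [neg_pow t]
    push_cast
    ring
  simp only [hterm]
  rw [← Complex.ofReal_sum, ← Finset.mul_sum, ← Complex.ofReal_sub, ← Complex.ofReal_sub,
    Complex.norm_real]
  rw [Real.norm_eq_abs, Real.norm_eq_abs, Real.log_div one_ne_zero hq.1.ne', Real.log_one, zero_sub,
    ← htd, abs_of_pos (pow_pos ht _)]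
  have e3 : p + 1 + N + 1 = p + (N + 1) + 1 := by ring
  rw [e3]
  have hsign : ∀ A : ℝ, |A| = |(-1) ^ (p + 2) * A| := by
    intro A; rw [abs_mul, abs_neg_one_pow, one_mul]
  rw [hsign] at key
  refine le_trans (le_of_eq ?_) key
  congr 1
  ring
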